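/- Let e, f > 0 and let S be the boundary of the rhombus with center at the origin and diagonals of lengths 2e and 2f on the coordinate axes, i.e., S = {(x,y) ∈ ℝ² : |x|/e + |y|/f = 1}. Let d_1 and d_2 be the two lines through the origin parallel to the sides of the rhombus, d_1 = {(x,y) : fx + ey = 0} and d_2 = {(x,y) : fx − ey = 0}. Then for every point P ∈ S, max(dist(P, d_1), dist(P, d_2)) = ef/√(e² + f²), where dist denotes Euclidean distance from a point to a line. Hence every rhombus is a (v_1,v_2)-maximum circle with the same center and radius ef/√(e²+f²), for λ_1 = λ_2 = 1 and unit vectors v_1, v_2 perpendicular to the sides. -/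

import Mathlib

theorem max_abs_add_abs_sub_eq (a b : ℝ) : max |a + b| |a - b| = |a| + |b| := by
  refine le_antisymm (max_le (abs_add_le a b) (abs_sub a b)) ?_
  rcases abs_cases a with ⟨ha, _⟩ | ⟨ha, _⟩ <;> rcases abs_cases b with ⟨hb, _⟩ | ⟨hb, _⟩ <;>
    rw [ha, hb, le_max_iff]
  · exact Or.inl (le_abs_self _)
  · exact Or.inr (by linarith [le_abs_self (a - b)])
  · exact Or.inr (by linarith [neg_le_abs (a - b)])
  · exact Or.inl (by linarith [neg_le_abs (a + b)])

theorem rhombus_is_maximum_circle (e f : ℝ) (he : 0 < e) (hf : 0 < f)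
    (P : ℝ × ℝ) (hP : |P.1| / e + |P.2| / f = 1) :
    max (|f * P.1 + e * P.2| / Real.sqrt (f ^ 2 + e ^ 2))
        (|f * P.1 - e * P.2| / Real.sqrt (f ^ 2 + e ^ 2)) =
      e * f / Real.sqrt (e ^ 2 + f ^ 2) := by
  rw [max_div_div_right (Real.sqrt_nonneg _), max_abs_add_abs_sub_eq, abs_mul, abs_mul,
    abs_of_pos he, abs_of_pos hf, add_comm (f ^ 2)]
  congr 1
  field_simp at hP
  linarith
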